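/- Let ω ∈ Ω₊ be a cookie environment such that the site 0 is ω-transient. Then P_{0,ω}[X_n > 0 for all n > 0] > 0; that is, the walk started at 0 has positive probability of never returning to 0 and staying strictly positive. -/

import Mathlib

open MeasureTheory Filter Set Topology ProbabilityTheory
open scoped ENNReal ENat

noncomputable section

/-- A cookie environment: `ω z i` is the strength of the `(i+1)`-st cookie at site `z`
(cookies at each site are indexed by `i = 0, 1, 2, …`). -/
abbrev CEnv : Type := ℤ → ℕ → ℝ

/-- `ω` belongs to `Ω₊`, i.e. all cookie strengths lie in `[1/2, 1]`. -/
def IsCookieEnv (ω : CEnv) : Prop := ∀ z i, ω z i ∈ Set.Icc (1/2 : ℝ) 1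

/-- The number of visits of the path `x` to the site `x n` at times `m < n`. -/
def prevVisits (x : ℕ → ℤ) (n : ℕ) : ℕ :=
  ((Finset.range n).filter fun m => x m = x n).card

/-- The probability of the step from `x n` to `x (n+1)` for the multi-excited random
walk: jump to the right with the strength of the bottom remaining cookie at the current
site, to the left with the complementary probability. -/
def stepProb (ω : CEnv) (x : ℕ → ℤ) (n : ℕ) : ℝ :=
  if x (n+1) = x n + 1 then ω (x n) (prevVisits x n)
  else if x (n+1) = x n - 1 then 1 - ω (x n) (prevVisits x n)
  else 0

/-- The probability that the walk started at `x0` follows the path `x` up to time `n`. -/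
def cylProb (ω : CEnv) (x0 : ℤ) (x : ℕ → ℤ) (n : ℕ) : ℝ :=
  (if x 0 = x0 then 1 else 0) * ∏ m ∈ Finset.range n, stepProb ω x m

/-- `P` is the law `P_{x0,ω}` of the multi-excited random walk in the cookie
environment `ω` started at `x0`, characterized by its cylinder probabilities. -/
def IsERWLaw (ω : CEnv) (x0 : ℤ) (P : Measure (ℕ → ℤ)) : Prop :=
  IsProbabilityMeasure P ∧
    ∀ (x : ℕ → ℤ) (n : ℕ),
      P {Y | ∀ m ≤ n, Y m = x m} = ENNReal.ofReal (cylProb ω x0 x n)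

/-- First passage time `T_k`, with value `∞` if `k` is never visited. -/
def T (k : ℤ) (Y : ℕ → ℤ) : ℕ∞ :=
  sInf {t : ℕ∞ | ∃ n : ℕ, (n : ℕ∞) = t ∧ Y n = k}

/-- First passage time of an extended-real level, with the convention
`T_{−∞} = T_{+∞} = ∞`. -/
def Te (k : EReal) (Y : ℕ → ℤ) : ℕ∞ :=
  sInf {t : ℕ∞ | ∃ n : ℕ, (n : ℕ∞) = t ∧ ((Y n : ℝ) : EReal) = k}

/-- `R_k`, the event that the site `k` is visited infinitely often. -/
def Rset (k : ℤ) : Set (ℕ → ℤ) := {Y | ∀ N : ℕ, ∃ n ≥ N, Y n = k}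

/-- The number of visits of `Y` to the site `s` at times `< t`. -/
def visitsBefore (Y : ℕ → ℤ) (s : ℤ) (t : ℕ∞) : ℕ∞ :=
  {m : ℕ | (m : ℕ∞) < t ∧ Y m = s}.encard

/-- `D_t^s`: the total drift stored in the cookies consumed at the site `s`
before time `t` (a time in `ℕ∞`; `t = ∞` gives `D_∞^s`). -/
def driftAt (ω : CEnv) (Y : ℕ → ℤ) (s : ℤ) (t : ℕ∞) : ℝ≥0∞ :=
  ∑' i : ℕ, Set.indicator {i : ℕ | (i : ℕ∞) < visitsBefore Y s t}
    (fun i => ENNReal.ofReal (2 * ω s i - 1)) i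

/-- `D_t`: the total drift consumed before time `t` (at all sites). -/
def Dtot (ω : CEnv) (Y : ℕ → ℤ) (t : ℕ∞) : ℝ≥0∞ := ∑' s : ℤ, driftAt ω Y s t

/-- `D_t^+`: the total drift consumed at nonnegative sites before time `t`. -/
def DtotPos (ω : CEnv) (Y : ℕ → ℤ) (t : ℕ∞) : ℝ≥0∞ := ∑' s : ℕ, driftAt ω Y (s : ℤ) t

/-- `δ^s`: the total drift stored in the cookies at the site `s`. -/
def cookieDrift (ω : CEnv) (s : ℤ) : ℝ≥0∞ := ∑' i : ℕ, ENNReal.ofReal (2 * ω s i - 1)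

/-- The successive times `τ_{k,1}, τ_{k,2}, …` (indexed here from `0`) at which the
walk is at a site `≥ k`. -/
def tauT (k : ℤ) (Y : ℕ → ℤ) : ℕ → ℕ∞
  | 0 => sInf {t : ℕ∞ | ∃ n : ℕ, (n : ℕ∞) = t ∧ k ≤ Y n}
  | m + 1 => sInf {t : ℕ∞ | ∃ n : ℕ, (n : ℕ∞) = t ∧ tauT k Y m < (n : ℕ∞) ∧ k ≤ Y n}

/-- The observed sequence `(X_{τ_{k,m}})_{m ≥ 1}` (indexed here from `0`). -/
def obsSeq (k : ℤ) (Y : ℕ → ℤ) (m : ℕ) : ℤ := Y (tauT k Y m).toNat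

/-- The one-sided shift on sequences. -/
def shiftSeq {α : Type*} (u : ℕ → α) : ℕ → α := fun n => u (n + 1)

/-- The restriction `(ω(x))_{x ≥ 0}` of an environment to the nonnegative sites. -/
def restrictNN (ω : CEnv) : ℕ → ℕ → ℝ := fun x => ω (x : ℤ)

/-- `(ω(x))_{x ≥ 0}` is stationary under `Pr`: its law is invariant under the shift. -/
def IsStationaryEnv (Pr : Measure CEnv) : Prop :=
  MeasurePreserving shiftSeq (Pr.map restrictNN) (Pr.map restrictNN)

/-- `(ω(x))_{x ≥ 0}` is stationary and ergodic under `Pr`. -/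
def IsStatErgEnv (Pr : Measure CEnv) : Prop :=
  Ergodic shiftSeq (Pr.map restrictNN)

/-- The process `ξ_k = ((ω(x+k))_{x≥0}, (X_{τ_{k,m}} − k)_{m≥0})` consisting of the
environment to the right of `k` and the trajectory at sites `≥ k`, recentered at `k`. -/
def xiProc (p : CEnv × (ℕ → ℤ)) (k : ℕ) : (ℕ → ℕ → ℝ) × (ℕ → ℤ) :=
  (fun x : ℕ => p.1 ((x : ℤ) + (k : ℤ)), fun m => obsSeq (k : ℤ) p.2 m - (k : ℤ))

/-- The number of visits of the path `x` to each site at times `< n`. -/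
def visitCount (x : ℕ → ℤ) (n : ℕ) : ℤ → ℕ :=
  fun z => ((Finset.range n).filter fun m => x m = z).card

/-- The visit counts after one more visit to `y`. -/
def bump (c : ℤ → ℕ) (y : ℤ) : ℤ → ℕ := Function.update c y (c y + 1)

/-- The probability that the walk currently at `y`, with past visits counted by `c`,
does not hit `0` during the next `k` steps. -/
def avoidProb (ω : CEnv) : ℕ → (ℤ → ℕ) → ℤ → ℝ
  | 0, _, _ => 1
  | k + 1, c, y =>
      ω y (c y) * (if y + 1 = 0 then 0 else avoidProb ω k (bump c y) (y + 1)) +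
        (1 - ω y (c y)) * (if y - 1 = 0 then 0 else avoidProb ω k (bump c y) (y - 1))

/-- Survival probabilities of the simple symmetric random walk on `ℕ` killed at `0`. -/
def srwSurvival : ℕ → ℕ → ℝ
  | _, 0 => 0
  | 0, _ + 1 => 1
  | k + 1, y + 1 => (srwSurvival k (y + 2) + srwSurvival k y) / 2

lemma visitCount_zero (x : ℕ → ℤ) : visitCount x 0 = fun _ => 0 := by
  funext z; simp [visitCount]

lemma visitCount_succ (x : ℕ → ℤ) (n : ℕ) :
    visitCount x (n + 1) = bump (visitCount x n) (x n) := by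
  funext z
  by_cases h : z = x n
  · subst h
    simp [visitCount, bump, Finset.range_add_one, Finset.filter_insert]
  · have h' : ¬ x n = z := fun e => h e.symm
    simp [visitCount, bump, Finset.range_add_one, Finset.filter_insert, h, h']

lemma visitCount_congr {x x' : ℕ → ℤ} {n : ℕ} (h : ∀ m < n, x m = x' m) :
    visitCount x n = visitCount x' n := by
  induction n with
  | zero => simp [visitCount_zero]
  | succ n ih =>
    rw [visitCount_succ, visitCount_succ, ih fun m hm => h m (by omega), h n (by omega)]

lemma prevVisits_eq (x : ℕ → ℤ) (n : ℕ) : prevVisits x n = visitCount x n (x n) := rfl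

lemma stepProb_congr (ω : CEnv) {x x' : ℕ → ℤ} {n : ℕ} (h : ∀ m ≤ n + 1, x m = x' m) :
    stepProb ω x n = stepProb ω x' n := by
  simp only [stepProb, prevVisits_eq]
  rw [visitCount_congr fun m hm => h m (by omega), h n (by omega), h (n + 1) le_rfl]

lemma cylProb_succ (ω : CEnv) (x0 : ℤ) (x : ℕ → ℤ) (n : ℕ) :
    cylProb ω x0 x (n + 1) = cylProb ω x0 x n * stepProb ω x n := by
  simp [cylProb, Finset.prod_range_succ]

lemma cylProb_congr (ω : CEnv) (x0 : ℤ) {x x' : ℕ → ℤ} {n : ℕ} (h : ∀ m ≤ n, x m = x' m) :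
    cylProb ω x0 x n = cylProb ω x0 x' n := by
  induction n with
  | zero => simp [cylProb, h 0 le_rfl]
  | succ n ih =>
    rw [cylProb_succ, cylProb_succ, ih fun m hm => h m (by omega), stepProb_congr ω h]

lemma stepProb_nonneg {ω : CEnv} (hω : IsCookieEnv ω) (x : ℕ → ℤ) (n : ℕ) :
    0 ≤ stepProb ω x n := by
  have h := hω (x n) (prevVisits x n)
  simp only [Set.mem_Icc] at h
  unfold stepProb
  split_ifs <;> linarith

lemma cylProb_nonneg {ω : CEnv} (hω : IsCookieEnv ω) (x0 : ℤ) (x : ℕ → ℤ) (n : ℕ) :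
    0 ≤ cylProb ω x0 x n := by
  unfold cylProb
  refine mul_nonneg (by split_ifs <;> simp) (Finset.prod_nonneg fun m _ => stepProb_nonneg hω x m)

lemma avoidProb_nonneg {ω : CEnv} (hω : IsCookieEnv ω) (k : ℕ) (c : ℤ → ℕ) (y : ℤ) :
    0 ≤ avoidProb ω k c y := by
  induction k generalizing c y with
  | zero => simp [avoidProb]
  | succ k ih =>
    have h := hω y (c y)
    simp only [Set.mem_Icc] at h
    have h1 : 0 ≤ 1 - ω y (c y) := by linarith
    have h2 : 0 ≤ ω y (c y) := by linarith
    have := ih (bump c y) (y + 1)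
    have := ih (bump c y) (y - 1)
    unfold avoidProb
    split_ifs <;> positivity

lemma avoidProb_succ_one (ω : CEnv) (k : ℕ) (c : ℤ → ℕ) :
    avoidProb ω (k + 1) c 1 = ω 1 (c 1) * avoidProb ω k (bump c 1) 2 := by
  simp [avoidProb]

lemma avoidProb_succ_pos (ω : CEnv) (k : ℕ) (c : ℤ → ℕ) {y : ℤ} (hy : 2 ≤ y) :
    avoidProb ω (k + 1) c y = ω y (c y) * avoidProb ω k (bump c y) (y + 1) +
      (1 - ω y (c y)) * avoidProb ω k (bump c y) (y - 1) := by
  rw [avoidProb, if_neg (by omega), if_neg (by omega)]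

lemma bump_agree {c c' : ℤ → ℕ} (h : ∀ z, 1 ≤ z → c z = c' z) (y : ℤ) :
    ∀ z, 1 ≤ z → bump c y z = bump c' y z := by
  intro z hz
  by_cases hzy : z = y
  · subst hzy; simp [bump, h z hz]
  · simp [bump, hzy, h z hz]

lemma bump_of_nonpos (c : ℤ → ℕ) {y : ℤ} (hy : y ≤ 0) :
    ∀ z, 1 ≤ z → bump c y z = c z := by
  intro z hz
  simp [bump, show z ≠ y by omega]

lemma bump_comm (c : ℤ → ℕ) (y z : ℤ) : bump (bump c y) z = bump (bump c z) y := by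
  by_cases h : y = z
  · rw [h]
  · simp only [bump]
    rw [Function.update_of_ne (Ne.symm h), Function.update_of_ne h, Function.update_comm h]

lemma bump_of_ne (c : ℤ → ℕ) {y z : ℤ} (h : z ≠ y) : bump c y z = c z := by
  simp [bump, h]

/-- To the right of `0`, the probability of avoiding `0` ignores the cookies at sites `≤ 0`. -/
lemma avoidProb_congr (ω : CEnv) (k : ℕ) {c c' : ℤ → ℕ} (h : ∀ z, 1 ≤ z → c z = c' z)
    {y : ℤ} (hy : 1 ≤ y) : avoidProb ω k c y = avoidProb ω k c' y := by
  induction k generalizing c c' y with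
  | zero => simp [avoidProb]
  | succ k ih =>
    rcases hy.lt_or_eq with hy | rfl
    · rw [avoidProb_succ_pos ω k c hy, avoidProb_succ_pos ω k c' hy, h y (by omega),
        ih (bump_agree h y) (by omega), ih (bump_agree h y) (by omega)]
    · rw [avoidProb_succ_one, avoidProb_succ_one, h 1 le_rfl, ih (bump_agree h 1) (by omega)]

/-- Starting further to the right, or replacing the lowest cookie at `1` by a right step,
helps in avoiding `0`. -/
lemma avoidProb_one_le_two_and {ω : CEnv} (hω : IsCookieEnv ω) (k : ℕ) :
    (∀ c, avoidProb ω k c 1 ≤ avoidProb ω k c 2) ∧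
      ∀ c y, 2 ≤ y → ω 1 (c 1) * avoidProb ω k (bump c 1) y ≤ avoidProb ω (k + 1) c y := by
  induction k with
  | zero =>
    refine ⟨fun c => by simp [avoidProb], fun c y hy => ?_⟩
    have h := hω 1 (c 1)
    simp only [Set.mem_Icc] at h
    rw [avoidProb_succ_pos ω 0 c hy]
    simp only [avoidProb]
    linarith
  | succ k ih =>
    obtain ⟨ihA, ihB⟩ := ih
    refine ⟨fun c => ?_, fun c y hy => ?_⟩
    · rw [avoidProb_succ_one]
      exact ihB c 2 le_rfl
    · have h := hω y (c y)
      simp only [Set.mem_Icc] at h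
      have h1 := hω 1 (c 1)
      simp only [Set.mem_Icc] at h1
      have e1 : bump c y 1 = c 1 := bump_of_ne c (by omega)
      have e2 : bump c 1 y = c y := bump_of_ne c (by omega)
      rw [avoidProb_succ_pos ω (k + 1) c hy, avoidProb_succ_pos ω k (bump c 1) hy, e2,
        bump_comm c 1 y]
      have hR := ihB (bump c y) (y + 1) (by omega)
      rw [e1] at hR
      have hL : ω 1 (c 1) * avoidProb ω k (bump (bump c y) 1) (y - 1) ≤
          avoidProb ω (k + 1) (bump c y) (y - 1) := by
        rcases hy.lt_or_eq with hy | rfl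
        · have := ihB (bump c y) (y - 1) (by omega)
          rwa [e1] at this
        · have h21 : (2 : ℤ) - 1 = 1 := by norm_num
          rw [h21, avoidProb_succ_one, e1]
          exact mul_le_mul_of_nonneg_left (ihA _) (by linarith)
      nlinarith

lemma srwSurvival_zero (k : ℕ) : srwSurvival k 0 = 0 := by
  cases k <;> simp [srwSurvival]

lemma srwSurvival_mem (k y : ℕ) : 0 ≤ srwSurvival k y ∧ srwSurvival k y ≤ 1 := by
  induction k generalizing y with
  | zero => cases y <;> simp [srwSurvival]
  | succ k ih =>
    cases y with
    | zero => simp [srwSurvival]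
    | succ y =>
      have := ih y
      have := ih (y + 2)
      simp only [srwSurvival]
      constructor <;> linarith

lemma srwSurvival_mono (k y : ℕ) : srwSurvival k y ≤ srwSurvival k (y + 1) := by
  induction k generalizing y with
  | zero => cases y <;> simp [srwSurvival]
  | succ k ih =>
    cases y with
    | zero => rw [srwSurvival_zero]; exact (srwSurvival_mem _ _).1
    | succ y =>
      have := ih y
      have := ih (y + 2)
      simp only [srwSurvival]
      linarith

lemma srwSurvival_antitone (y : ℕ) : Antitone fun k => srwSurvival k y := by
  refine antitone_nat_of_succ_le fun k => ?_
  induction k generalizing y with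
  | zero =>
    cases y with
    | zero => simp [srwSurvival]
    | succ y => exact (srwSurvival_mem _ _).2
  | succ k ih =>
    cases y with
    | zero => simp [srwSurvival]
    | succ y =>
      have h1 := ih y
      have h2 := ih (y + 2)
      simp only [srwSurvival] at h1 h2 ⊢
      linarith

/-- Recurrence of the simple symmetric random walk. -/
lemma tendsto_srwSurvival (y : ℕ) : Tendsto (fun k => srwSurvival k y) atTop (𝓝 0) := by
  have hbdd : ∀ y, BddBelow (Set.range fun k => srwSurvival k y) := fun y =>
    ⟨0, by rintro _ ⟨k, rfl⟩; exact (srwSurvival_mem k y).1⟩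
  have hlim : ∀ y, ∃ l, Tendsto (fun k => srwSurvival k y) atTop (𝓝 l) := fun y =>
    ⟨_, tendsto_atTop_ciInf (srwSurvival_antitone y) (hbdd y)⟩
  choose s hs using hlim
  have hs0 : s 0 = 0 := by
    refine tendsto_nhds_unique (hs 0) ?_
    simp [srwSurvival_zero]
  have hharm : ∀ y, s (y + 1) = (s (y + 2) + s y) / 2 := fun y => by
    refine tendsto_nhds_unique ((tendsto_add_atTop_iff_nat 1).2 (hs (y + 1))) ?_
    simpa only [srwSurvival] using ((hs (y + 2)).add (hs y)).div_const 2
  have hlin : ∀ y : ℕ, s y = y * s 1 ∧ s (y + 1) = (y + 1) * s 1 := by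
    intro y
    induction y with
    | zero => simp [hs0]
    | succ y ih =>
      have := hharm y
      push_cast
      refine ⟨ih.2, ?_⟩
      rw [show y + 1 + 1 = y + 2 from rfl]
      linarith [ih.1, ih.2]
  have hle : ∀ y, s y ≤ 1 := fun y => le_of_tendsto' (hs y) fun k => (srwSurvival_mem k y).2
  have hge : 0 ≤ s 1 := ge_of_tendsto' (hs 1) fun k => (srwSurvival_mem k 1).1
  have hs1 : s 1 = 0 := by
    by_contra hne
    have hpos : 0 < s 1 := lt_of_le_of_ne hge (Ne.symm hne)
    obtain ⟨n, hn⟩ := exists_nat_gt (1 / s 1)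
    have h1 := hle n
    rw [(hlin n).1] at h1
    rw [div_lt_iff₀ hpos] at hn
    linarith
  have := hs y
  rwa [(hlin y).1, hs1, mul_zero] at this

lemma avoidProb_neg_le {ω : CEnv} (hω : IsCookieEnv ω) (k : ℕ) (c : ℤ → ℕ) (y : ℕ) :
    avoidProb ω k c (-((y : ℤ) + 1)) ≤ srwSurvival k (y + 1) := by
  induction k generalizing c y with
  | zero => simp [avoidProb, srwSurvival]
  | succ k ih =>
    set z : ℤ := -((y : ℤ) + 1) with hz
    have h := hω z (c z)
    simp only [Set.mem_Icc] at h
    have hL : avoidProb ω k (bump c z) (z - 1) ≤ srwSurvival k (y + 2) := by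
      have := ih (bump c z) (y + 1)
      rwa [show -(((y + 1 : ℕ) : ℤ) + 1) = z - 1 by push_cast; omega] at this
    have hR : (if z + 1 = 0 then 0 else avoidProb ω k (bump c z) (z + 1)) ≤ srwSurvival k y := by
      split_ifs with h0
      · exact (srwSurvival_mem k y).1
      · obtain ⟨y', rfl⟩ : ∃ y', y = y' + 1 := ⟨y - 1, by omega⟩
        have := ih (bump c z) y'
        rwa [show -((y' : ℤ) + 1) = z + 1 by push_cast at hz; omega] at this
    have m1 := srwSurvival_mono k y
    have m2 := srwSurvival_mono k (y + 1)
    rw [avoidProb, if_neg (show ¬ z - 1 = 0 by omega), srwSurvival]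
    have hm : srwSurvival k y ≤ srwSurvival k (y + 2) := m1.trans m2
    have a1 := mul_le_mul_of_nonneg_left hR (show 0 ≤ ω z (c z) by linarith)
    have a2 := mul_le_mul_of_nonneg_left hL (show 0 ≤ 1 - ω z (c z) by linarith)
    nlinarith

lemma tendsto_avoidProb_neg_one {ω : CEnv} (hω : IsCookieEnv ω) (c : ℤ → ℕ) :
    Tendsto (fun k => avoidProb ω k c (-1)) atTop (𝓝 0) :=
  squeeze_zero (fun k => avoidProb_nonneg hω k c _)
    (fun k => by simpa using avoidProb_neg_le hω k c 0) (tendsto_srwSurvival 1)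

lemma tendsto_zero_of_mul_le_succ {f g : ℕ → ℝ} {a : ℝ} (ha : 0 < a) (hf : ∀ k, 0 ≤ f k)
    (hfg : ∀ k, a * f k ≤ g (k + 1)) (hg : Tendsto g atTop (𝓝 0)) :
    Tendsto f atTop (𝓝 0) := by
  have h := ((tendsto_add_atTop_iff_nat 1).2 hg).div_const a
  rw [zero_div] at h
  refine squeeze_zero hf (fun k => ?_) h
  rw [le_div_iff₀ ha]
  linarith [hfg k]

lemma tendsto_avoidProb_right {ω : CEnv} (hω : IsCookieEnv ω) {c : ℤ → ℕ} {y : ℤ} (hy : 1 ≤ y)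
    (h : Tendsto (fun k => avoidProb ω k c y) atTop (𝓝 0)) :
    Tendsto (fun k => avoidProb ω k (bump c y) (y + 1)) atTop (𝓝 0) := by
  have hm := hω y (c y)
  simp only [Set.mem_Icc] at hm
  refine tendsto_zero_of_mul_le_succ (a := ω y (c y)) (by linarith)
    (fun k => avoidProb_nonneg hω k _ _) (fun k => ?_) h
  rcases hy.lt_or_eq with hy | rfl
  · rw [avoidProb_succ_pos ω k c hy]
    have := avoidProb_nonneg hω k (bump c y) (y - 1)
    nlinarith
  · exact (avoidProb_succ_one ω k c).ge

lemma tendsto_avoidProb_left {ω : CEnv} (hω : IsCookieEnv ω) {c : ℤ → ℕ} {y : ℤ} (hy : 2 ≤ y)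
    (hq : 1 - ω y (c y) ≠ 0) (h : Tendsto (fun k => avoidProb ω k c y) atTop (𝓝 0)) :
    Tendsto (fun k => avoidProb ω k (bump c y) (y - 1)) atTop (𝓝 0) := by
  have hm := hω y (c y)
  simp only [Set.mem_Icc] at hm
  refine tendsto_zero_of_mul_le_succ (a := 1 - ω y (c y))
    (lt_of_le_of_ne (by linarith) (Ne.symm hq))
    (fun k => avoidProb_nonneg hω k _ _) (fun k => ?_) h
  rw [avoidProb_succ_pos ω k c hy]
  have := avoidProb_nonneg hω k (bump c y) (y + 1)
  nlinarith

/-- If the walk started at `1` hits `0` almost surely, then so does the walk from any position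
to the right of `0` after any possible history. -/
lemma tendsto_avoidProb_of_reachable {ω : CEnv} (hω : IsCookieEnv ω)
    (h1 : Tendsto (fun k => avoidProb ω k (fun _ => 0) 1) atTop (𝓝 0))
    (x : ℕ → ℤ) (n : ℕ) (hx : cylProb ω 0 x n ≠ 0) :
    Tendsto (fun k => avoidProb ω k (visitCount x n) (max (x n) 1)) atTop (𝓝 0) := by
  induction n with
  | zero =>
    have hx0 : x 0 = 0 := by
      by_contra hne
      simp [cylProb, hne] at hx
    simpa [hx0, visitCount_zero] using h1
  | succ n ih =>
    rw [cylProb_succ] at hx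
    have hstep := right_ne_zero_of_mul hx
    specialize ih (left_ne_zero_of_mul hx)
    rw [visitCount_succ]
    set c := visitCount x n
    rw [stepProb, prevVisits_eq] at hstep
    by_cases hy : x n ≤ 0
    · rw [max_eq_right (by omega)] at ih
      have hle : max (x (n + 1)) 1 = 1 := by
        split_ifs at hstep <;> first | omega | exact absurd rfl hstep
      rw [hle]
      simpa only [avoidProb_congr ω _ (bump_of_nonpos c hy) le_rfl] using ih
    · rw [max_eq_left (by omega)] at ih
      split_ifs at hstep with hr hl
      · rw [max_eq_left (by omega), hr]
        exact tendsto_avoidProb_right hω (by omega) ih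
      · by_cases hy2 : 2 ≤ x n
        · rw [max_eq_left (by omega), hl]
          exact tendsto_avoidProb_left hω hy2 hstep ih
        · have hx1 : x n = 1 := by omega
          rw [max_eq_right (by omega), hx1]
          rw [hx1] at ih
          exact squeeze_zero (fun k => avoidProb_nonneg hω k _ _)
            (fun k => (avoidProb_one_le_two_and hω k).1 _)
            (tendsto_avoidProb_right hω le_rfl ih)
      · exact absurd rfl hstep

lemma tendsto_avoidProb_zero {ω : CEnv} (hω : IsCookieEnv ω) {c : ℤ → ℕ}
    (h : Tendsto (fun k => avoidProb ω k c 1) atTop (𝓝 0)) :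
    Tendsto (fun k => avoidProb ω k c 0) atTop (𝓝 0) := by
  rw [← tendsto_add_atTop_iff_nat 1]
  have h' : Tendsto (fun k => avoidProb ω k (bump c 0) 1) atTop (𝓝 0) := by
    simpa only [avoidProb_congr ω _ (bump_of_nonpos c le_rfl) le_rfl] using h
  have := (h'.const_mul (ω 0 (c 0))).add
    ((tendsto_avoidProb_neg_one hω (bump c 0)).const_mul (1 - ω 0 (c 0)))
  simpa [avoidProb] using this

/-- The paths following `x` up to time `n` and avoiding `0` during the next `k` steps. -/
def avoidSet (x : ℕ → ℤ) (n k : ℕ) : Set (ℕ → ℤ) :=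
  {Y | (∀ m ≤ n, Y m = x m) ∧ ∀ m, n < m → m ≤ n + k → Y m ≠ 0}

lemma measurableSet_avoidSet (x : ℕ → ℤ) (n k : ℕ) : MeasurableSet (avoidSet x n k) := by
  have h1 : ∀ (m : ℕ) (s : Set ℤ), MeasurableSet {Y : ℕ → ℤ | Y m ∈ s} := fun m s =>
    measurable_pi_apply m (MeasurableSet.of_discrete (s := s))
  have : avoidSet x n k = (⋂ m, ⋂ (_ : m ≤ n), {Y : ℕ → ℤ | Y m ∈ ({x m} : Set ℤ)}) ∩
      ⋂ m, ⋂ (_ : n < m), ⋂ (_ : m ≤ n + k), {Y : ℕ → ℤ | Y m ∈ ({0}ᶜ : Set ℤ)} := by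
    ext Y
    simp [avoidSet]
  rw [this]
  refine MeasurableSet.inter ?_ ?_
  · exact MeasurableSet.iInter fun m => MeasurableSet.iInter fun _ => h1 m _
  · exact MeasurableSet.iInter fun m => MeasurableSet.iInter fun _ =>
      MeasurableSet.iInter fun _ => h1 m _

lemma measure_eq_zero_of_cylinders (P : Measure (ℕ → ℤ)) (E : Set (ℕ → ℤ)) (n : ℕ)
    (h : ∀ x : ℕ → ℤ, P (E ∩ {Y | ∀ m ≤ n, Y m = x m}) = 0) : P E = 0 := by
  let ext : (Fin (n + 1) → ℤ) → ℕ → ℤ := fun f m => if hm : m < n + 1 then f ⟨m, hm⟩ else 0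
  refine measure_mono_null (t := ⋃ f, E ∩ {Y | ∀ m ≤ n, Y m = ext f m}) ?_
    (measure_iUnion_null fun f => h _)
  intro Y hY
  refine Set.mem_iUnion.2 ⟨fun i => Y i, hY, fun m hm => ?_⟩
  simp only [ext, dif_pos (Nat.lt_succ_of_le hm)]

lemma ae_nearest_neighbor {ω : CEnv} {x0 : ℤ} {P : Measure (ℕ → ℤ)} (hP : IsERWLaw ω x0 P) :
    ∀ᵐ Y ∂P, ∀ n, Y (n + 1) = Y n + 1 ∨ Y (n + 1) = Y n - 1 := by
  rw [ae_all_iff]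
  intro n
  rw [ae_iff]
  refine measure_eq_zero_of_cylinders P _ (n + 1) fun x => ?_
  by_cases hx : x (n + 1) = x n + 1 ∨ x (n + 1) = x n - 1
  · convert measure_empty (μ := P)
    ext Y
    simp only [Set.mem_inter_iff, Set.mem_ofPred_eq, Set.mem_empty_iff_false, iff_false, not_and]
    intro h1 h2
    rw [h2 n (by omega), h2 (n + 1) le_rfl] at h1
    exact h1 hx
  · push Not at hx
    refine measure_mono_null Set.inter_subset_right ?_
    rw [hP.2, cylProb_succ, stepProb, if_neg hx.1, if_neg hx.2]
    simp

lemma cylProb_update (ω : CEnv) (x0 : ℤ) (x : ℕ → ℤ) (n : ℕ) (v : ℤ) :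
    cylProb ω x0 (Function.update x (n + 1) v) (n + 1) = cylProb ω x0 x n *
      if v = x n + 1 then ω (x n) (visitCount x n (x n))
      else if v = x n - 1 then 1 - ω (x n) (visitCount x n (x n)) else 0 := by
  have hm : ∀ m ≤ n, Function.update x (n + 1) v m = x m := fun m hm =>
    Function.update_of_ne (by omega) _ _
  rw [cylProb_succ, cylProb_congr ω x0 hm, stepProb, prevVisits_eq,
    visitCount_congr fun m hm' => hm m (by omega), hm n le_rfl, Function.update_self]

lemma visitCount_update (x : ℕ → ℤ) (n : ℕ) (v : ℤ) :
    visitCount (Function.update x (n + 1) v) (n + 1) = bump (visitCount x n) (x n) := by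
  rw [← visitCount_succ]
  exact visitCount_congr fun m hm => Function.update_of_ne (by omega) _ _

lemma mem_avoidSet_update {x Y : ℕ → ℤ} {n k : ℕ} {v : ℤ} :
    (v ≠ 0 ∧ Y ∈ avoidSet (Function.update x (n + 1) v) (n + 1) k) ↔
      Y ∈ avoidSet x n (k + 1) ∧ Y (n + 1) = v := by
  constructor
  · rintro ⟨hv, h1, h2⟩
    have hY : Y (n + 1) = v := by simpa using h1 (n + 1) le_rfl
    refine ⟨⟨fun m hm => ?_, fun m hm hm' => ?_⟩, hY⟩
    · rw [h1 m (by omega), Function.update_of_ne (by omega)]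
    · rcases (Nat.succ_le_of_lt hm).lt_or_eq with h | h
      · exact h2 m h (by omega)
      · rw [← h, Nat.succ_eq_add_one, hY]; exact hv
  · rintro ⟨⟨h1, h2⟩, rfl⟩
    refine ⟨h2 (n + 1) (by omega) (by omega), fun m hm => ?_, fun m hm hm' =>
      h2 m (by omega) (by omega)⟩
    rcases hm.lt_or_eq with h | rfl
    · rw [h1 m (by omega), Function.update_of_ne (by omega)]
    · simp

lemma measure_avoidSet {ω : CEnv} (hω : IsCookieEnv ω) {x0 : ℤ} {P : Measure (ℕ → ℤ)}
    (hP : IsERWLaw ω x0 P) (x : ℕ → ℤ) (n k : ℕ) :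
    P (avoidSet x n k) =
      ENNReal.ofReal (cylProb ω x0 x n * avoidProb ω k (visitCount x n) (x n)) := by
  induction k generalizing x n with
  | zero =>
    rw [avoidProb, mul_one, ← hP.2]
    congr 1
    ext Y
    simp only [avoidSet, Set.mem_ofPred_eq, and_iff_left_iff_imp]
    intro _ m h1 h2
    omega
  | succ k ih =>
    let F : ℤ → Set (ℕ → ℤ) := fun v =>
      {Y | v ≠ 0 ∧ Y ∈ avoidSet (Function.update x (n + 1) v) (n + 1) k}
    have hF : ∀ v, F v = if v = 0 then ∅ else avoidSet (Function.update x (n + 1) v) (n + 1) k := by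
      intro v
      ext Y
      by_cases hv : v = 0 <;> simp [F, hv]
    have hFmeas : ∀ v, MeasurableSet (F v) := by
      intro v
      rw [hF]
      split_ifs
      · exact MeasurableSet.empty
      · exact measurableSet_avoidSet _ _ _
    have hFP : ∀ v, P (F v) = ENNReal.ofReal
        (cylProb ω x0 (Function.update x (n + 1) v) (n + 1) *
          if v = 0 then 0 else avoidProb ω k (bump (visitCount x n) (x n)) v) := by
      intro v
      rw [hF]
      split_ifs
      · simp
      · rw [ih, visitCount_update, Function.update_self]
    have hae : (avoidSet x n (k + 1) : Set (ℕ → ℤ)) =ᵐ[P]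
        (F (x n + 1) ∪ F (x n - 1) : Set (ℕ → ℤ)) := by
      rw [eventuallyEq_set]
      filter_upwards [ae_nearest_neighbor hP] with Y hY
      simp only [F, Set.mem_union, Set.mem_ofPred_eq, mem_avoidSet_update]
      constructor
      · intro h
        have hn := h.1 n le_rfl
        rcases hY n with h' | h'
        · exact Or.inl ⟨h, by rw [h', hn]⟩
        · exact Or.inr ⟨h, by rw [h', hn]⟩
      · rintro (h | h) <;> exact h.1
    have hdisj : Disjoint (F (x n + 1)) (F (x n - 1)) := by
      rw [Set.disjoint_left]
      intro Y h1 h2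
      simp only [F, Set.mem_ofPred_eq, mem_avoidSet_update] at h1 h2
      have := h1.2.symm.trans h2.2
      omega
    have hm := hω (x n) (visitCount x n (x n))
    simp only [Set.mem_Icc] at hm
    have hnn : ∀ v, 0 ≤ (if v = 0 then 0 else avoidProb ω k (bump (visitCount x n) (x n)) v) := by
      intro v
      split_ifs
      · exact le_rfl
      · exact avoidProb_nonneg hω _ _ _
    rw [measure_congr hae, measure_union hdisj (hFmeas _), hFP, hFP,
      ← ENNReal.ofReal_add (mul_nonneg (cylProb_nonneg hω _ _ _) (hnn _))
        (mul_nonneg (cylProb_nonneg hω _ _ _) (hnn _)),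
      cylProb_update, cylProb_update, if_pos rfl,
      if_neg (show ¬ x n - 1 = x n + 1 by omega), if_pos rfl, avoidProb]
    congr 1
    ring

/-- If the walk almost surely does not stay positive, then the walk started at `1`
hits `0` almost surely. -/
lemma tendsto_avoidProb_one {ω : CEnv} (hω : IsCookieEnv ω) {P : Measure (ℕ → ℤ)}
    (hP : IsERWLaw ω 0 P) (h : P {Y | ∀ n > 0, 0 < Y n} = 0) :
    Tendsto (fun k => avoidProb ω k (fun _ => 0) 1) atTop (𝓝 0) := by
  have := hP.1
  let x : ℕ → ℤ := fun n => n
  have hinter : P (⋂ k, avoidSet x 1 k) = 0 := by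
    refine measure_mono_null_ae ?_ h
    filter_upwards [ae_nearest_neighbor hP] with Y hY hmem
    have hmem' : ∀ k, Y ∈ avoidSet x 1 k := fun k => Set.mem_iInter.1 hmem k
    intro n hn
    induction n, hn using Nat.le_induction with
    | base => rw [(hmem' 0).1 1 le_rfl]; simp [x]
    | succ n hn ih =>
      have h0 := (hmem' n).2 (n + 1) (by omega) (by omega)
      rcases hY n with h' | h' <;> omega
  have hanti : Antitone fun k => avoidSet x 1 k := fun k l hkl Y hY =>
    ⟨hY.1, fun m h1 h2 => hY.2 m h1 (by omega)⟩
  have hlim := tendsto_measure_iInter_atTop (μ := P)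
    (fun k => (measurableSet_avoidSet x 1 k).nullMeasurableSet) hanti ⟨0, measure_ne_top _ _⟩
  rw [hinter] at hlim
  have hm := hω 0 0
  simp only [Set.mem_Icc] at hm
  have hcyl : cylProb ω 0 x 1 = ω 0 0 := by
    simp [cylProb, stepProb, prevVisits, x]
  have hcount : visitCount x 1 = bump (fun _ => 0) 0 := by
    rw [visitCount_succ, visitCount_zero]; simp [x]
  have hreal : Tendsto (fun k => ω 0 0 * avoidProb ω k (fun _ => 0) 1) atTop (𝓝 0) := by
    have h2 := (ENNReal.tendsto_toReal ENNReal.zero_ne_top).comp hlim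
    refine h2.congr fun k => ?_
    have hx1 : x 1 = 1 := by simp [x]
    simp only [Function.comp_apply]
    rw [measure_avoidSet hω hP, hcyl, hcount, hx1,
      avoidProb_congr ω k (bump_of_nonpos _ le_rfl) le_rfl, ENNReal.toReal_ofReal]
    exact mul_nonneg (by linarith) (avoidProb_nonneg hω _ _ _)
  have h3 := hreal.div_const (ω 0 0)
  rw [zero_div] at h3
  refine h3.congr fun k => ?_
  rw [mul_div_cancel_left₀]
  linarith

/-- Lemma 10. If `0` is `ω`-transient then
`P_{0,ω}[∀ n > 0 : X_n > 0] > 0`. -/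
theorem erw_positive_escape (ω : CEnv) (hω : IsCookieEnv ω)
    (P : ℤ → Measure (ℕ → ℤ)) (hP : ∀ x, IsERWLaw ω x (P x))
    (htrans : ∀ x, P x (Rset 0) = 0) :
    0 < P 0 {Y | ∀ n > 0, 0 < Y n} := by
  have hP0 := hP 0
  have := hP0.1
  rw [pos_iff_ne_zero]
  intro hzero
  have h1 := tendsto_avoidProb_one hω hP0 hzero
  have hlast : ∀ n, P 0 {Y | Y n = 0 ∧ ∀ m > n, Y m ≠ 0} = 0 := by
    intro n
    refine measure_eq_zero_of_cylinders _ _ n fun x => ?_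
    by_cases hx : x n = 0 ∧ cylProb ω 0 x n ≠ 0
    · have hlim := tendsto_avoidProb_of_reachable hω h1 x n hx.2
      rw [hx.1, max_eq_right zero_le_one] at hlim
      have hlim' := ENNReal.tendsto_ofReal
        ((tendsto_avoidProb_zero hω hlim).const_mul (cylProb ω 0 x n))
      rw [mul_zero, ENNReal.ofReal_zero] at hlim'
      refine le_antisymm (ge_of_tendsto' hlim' fun k => ?_) bot_le
      have hk := measure_avoidSet hω hP0 x n k
      rw [hx.1] at hk
      rw [← hk]
      exact measure_mono fun Y hY => ⟨hY.2, fun m hm _ => hY.1.2 m hm⟩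
    · by_cases hx0 : x n = 0
      · refine measure_mono_null Set.inter_subset_right ?_
        have : cylProb ω 0 x n = 0 := by
          by_contra hne
          exact hx ⟨hx0, hne⟩
        rw [hP0.2, this, ENNReal.ofReal_zero]
      · convert measure_empty (μ := P 0)
        ext Y
        simp only [Set.mem_inter_iff, Set.mem_ofPred_eq, Set.mem_empty_iff_false, iff_false,
          not_and]
        intro h2 h3
        exact hx0 ((h3 n le_rfl).symm.trans h2.1)
  have hstart : ∀ᵐ Y ∂(P 0), Y 0 = 0 := by
    rw [ae_iff]
    refine measure_eq_zero_of_cylinders _ _ 0 fun x => ?_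
    by_cases hx : x 0 = 0
    · convert measure_empty (μ := P 0)
      ext Y
      simp only [Set.mem_inter_iff, Set.mem_ofPred_eq, Set.mem_empty_iff_false, iff_false, not_and]
      intro h2 h3
      exact h2 ((h3 0 le_rfl).trans hx)
    · refine measure_mono_null Set.inter_subset_right ?_
      rw [hP0.2]
      simp [cylProb, hx]
  have hrec : ∀ᵐ Y ∂(P 0), Y ∈ Rset 0 := by
    have hall : ∀ᵐ Y ∂(P 0), ∀ n, ¬ (Y n = 0 ∧ ∀ m > n, Y m ≠ 0) :=
      ae_all_iff.2 fun n => by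
        rw [ae_iff]
        simpa only [not_not] using hlast n
    filter_upwards [hall, hstart] with Y hY h0 N
    induction N with
    | zero => exact ⟨0, le_rfl, h0⟩
    | succ N ih =>
      obtain ⟨n, hn, hn0⟩ := ih
      have h2 := hY n
      push Not at h2
      obtain ⟨m, hm, hm0⟩ := h2 hn0
      exact ⟨m, by omega, hm0⟩
  have hnot : ∀ᵐ Y ∂(P 0), Y ∉ Rset 0 := measure_eq_zero_iff_ae_notMem.1 (htrans 0)
  obtain ⟨Y, hY1, hY2⟩ := (hrec.and hnot).exists
  exact hY2 hY1

end
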